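/- Let a, γ, x be nonzero complex numbers with (a;q)_n ≠ 0 for all n ≥ 0. Then, as the real parameter ε tends to 0 from above, the big q-Bessel function J_{εγ}(x/ε; a; q) tends to the little q-Bessel function j_x(γ·a/q; a; q) = ₁φ₁(0; a; q, a·γ·x). -/

import Mathlib

open Filter Topology

/-- The q-shifted factorial `(a;q)_n = ∏_{j=0}^{n-1} (1 - a q^j)`. -/
noncomputable def qPoch (a q : ℂ) (n : ℕ) : ℂ := ∏ j ∈ Finset.range n, (1 - a * q ^ j)

/-- The big q-Bessel function
`J_γ(x;a;q) = ∑ (-1/x;q)_n (-1)^n q^{n(n-1)/2} / ((a;q)_n (q;q)_n) (aγx)^n`. -/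
noncomputable def bigQBessel (q a γ x : ℂ) : ℂ :=
  ∑' n : ℕ, qPoch (-1 / x) q n * (-1) ^ n * q ^ (n * (n - 1) / 2) /
    (qPoch a q n * qPoch q q n) * (a * γ * x) ^ n

/-- The little q-Bessel (Hahn-Exton q-Bessel) function
`j_γ(x;a;q) = ∑_{n≥0} (-1)^n q^{n(n-1)/2} / ((a;q)_n (q;q)_n) (qγx)^n`. -/
noncomputable def littleQBessel (q a γ x : ℂ) : ℂ :=
  ∑' n : ℕ, (-1) ^ n * q ^ (n * (n - 1) / 2) /
    (qPoch a q n * qPoch q q n) * (q * γ * x) ^ n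

/-- The basic hypergeometric series
`₁φ₁(α;β;q,z) = ∑_{n≥0} (α;q)_n (-1)^n q^{n(n-1)/2} / ((β;q)_n (q;q)_n) z^n`. -/
noncomputable def phi11 (q α β z : ℂ) : ℂ :=
  ∑' n : ℕ, qPoch α q n * (-1) ^ n * q ^ (n * (n - 1) / 2) /
    (qPoch β q n * qPoch q q n) * z ^ n

theorem qPoch_succ (a q : ℂ) (n : ℕ) : qPoch a q (n + 1) = qPoch a q n * (1 - a * q ^ n) :=
  Finset.prod_range_succ _ _

theorem qPoch_zero_left (q : ℂ) (n : ℕ) : qPoch 0 q n = 1 := by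
  simp [qPoch]

theorem continuous_qPoch_left (q : ℂ) (n : ℕ) : Continuous fun a => qPoch a q n := by
  unfold qPoch
  fun_prop

theorem norm_qPoch_le {a q : ℂ} (ha : ‖a‖ ≤ 1) (hq : ‖q‖ ≤ 1) (n : ℕ) :
    ‖qPoch a q n‖ ≤ 2 ^ n := by
  rw [qPoch, norm_prod]
  calc ∏ j ∈ Finset.range n, ‖1 - a * q ^ j‖ ≤ ∏ _j ∈ Finset.range n, (2 : ℝ) := by
        refine Finset.prod_le_prod (fun _ _ => norm_nonneg _) fun j _ => ?_
        have h : ‖a * q ^ j‖ ≤ 1 := by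
          rw [norm_mul, norm_pow]
          exact mul_le_one₀ ha (by positivity) (pow_le_one₀ (norm_nonneg _) hq)
        calc ‖1 - a * q ^ j‖ ≤ ‖(1 : ℂ)‖ + ‖a * q ^ j‖ := norm_sub_le _ _
          _ ≤ 2 := by rw [norm_one]; linarith
    _ = 2 ^ n := by simp

theorem qPoch_self_ne_zero {q : ℂ} (hq : ‖q‖ < 1) (n : ℕ) : qPoch q q n ≠ 0 := by
  refine Finset.prod_ne_zero_iff.2 fun j _ h => ?_
  have h1 : ‖q ^ (j + 1)‖ < 1 := by
    rw [norm_pow]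
    exact pow_lt_one₀ (norm_nonneg _) hq (by simp)
  rw [pow_succ', ← sub_eq_zero.1 h, norm_one] at h1
  exact lt_irrefl _ h1

/-- The coefficients of `₁φ₁(0;a;q,z)` give an everywhere absolutely convergent power series. -/
theorem summable_norm_phi11_term {q a : ℂ} (hq0 : q ≠ 0) (hq1 : ‖q‖ < 1)
    (ha : ∀ n, qPoch a q n ≠ 0) {z : ℂ} (hz : z ≠ 0) :
    Summable fun n : ℕ =>
      ‖(-1) ^ n * q ^ (n * (n - 1) / 2) / (qPoch a q n * qPoch q q n) * z ^ n‖ := by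
  have hqq := qPoch_self_ne_zero hq1
  have hpow : Tendsto (fun n : ℕ => q ^ n) atTop (𝓝 0) :=
    tendsto_pow_atTop_nhds_zero_of_norm_lt_one hq1
  have hlim : Tendsto (fun n : ℕ => ‖-(q ^ n * z) / ((1 - a * q ^ n) * (1 - q * q ^ n))‖)
      atTop (𝓝 0) := by
    have h := ((hpow.mul_const z).neg.div
      (((hpow.const_mul a).const_sub 1).mul ((hpow.const_mul q).const_sub 1)) (by simp)).norm
    simpa using h
  refine summable_of_ratio_test_tendsto_lt_one zero_lt_one
    (Eventually.of_forall fun n => ?_) (hlim.congr fun n => ?_)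
  · simp [hq0, hz, ha n, hqq n]
  · have h1 := ha (n + 1)
    have h2 := hqq (n + 1)
    rw [qPoch_succ] at h1 h2
    have h3 := ha n
    have h4 := hqq n
    have h5 := right_ne_zero_of_mul h1
    have h6 := right_ne_zero_of_mul h2
    rw [norm_norm, norm_norm, ← norm_div, Nat.triangle_succ, qPoch_succ, qPoch_succ, pow_add q]
    congr 1
    have h7 : ((-1 : ℂ)) ^ n ≠ 0 := by simp
    field_simp
    ring

theorem littleQBessel_eq_phi11 {q : ℂ} (hq : q ≠ 0) (a γ x : ℂ) :
    littleQBessel q a x (γ * a / q) = phi11 q 0 a (a * γ * x) := by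
  have h : q * x * (γ * a / q) = a * γ * x := by field_simp
  simp only [littleQBessel, phi11, qPoch_zero_left, one_mul, h]

theorem bigQBessel_to_littleQBessel_dual (q : ℝ) (hq0 : 0 < q) (hq1 : q < 1)
    (a γ x : ℂ) (ha : a ≠ 0) (hγ : γ ≠ 0) (hx : x ≠ 0)
    (haP : ∀ n : ℕ, qPoch a (q : ℂ) n ≠ 0) :
    Tendsto (fun ε : ℝ => bigQBessel (q : ℂ) a ((ε : ℂ) * γ) (x / (ε : ℂ)))
        (𝓝[>] (0 : ℝ)) (𝓝 (littleQBessel (q : ℂ) a x (γ * a / (q : ℂ)))) ∧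
      littleQBessel (q : ℂ) a x (γ * a / (q : ℂ)) =
        phi11 (q : ℂ) 0 a (a * γ * x) := by
  have hq : (q : ℂ) ≠ 0 := by exact_mod_cast hq0.ne'
  have hqn : ‖(q : ℂ)‖ < 1 := by simpa [abs_of_pos hq0] using hq1
  have heq := littleQBessel_eq_phi11 hq a γ x
  refine ⟨?_, heq⟩
  rw [heq]
  have hz : a * γ * x ≠ 0 := by simp [ha, hγ, hx]
  have hcont : Tendsto (fun ε : ℝ => -1 / (x / (ε : ℂ))) (𝓝[>] (0 : ℝ)) (𝓝 0) := by
    have h : Continuous fun ε : ℝ => -(ε : ℂ) / x := by fun_prop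
    have h0 := (h.tendsto 0).mono_left (nhdsWithin_le_nhds (s := Set.Ioi (0 : ℝ)))
    simp only [Complex.ofReal_zero, neg_zero, zero_div] at h0
    exact h0.congr fun ε => by rw [div_div_eq_mul_div, neg_one_mul]
  refine tendsto_tsum_of_dominated_convergence
    (summable_norm_phi11_term hq hqn haP (mul_ne_zero two_ne_zero hz)) (fun n => ?_) ?_
  · have hlim := ((continuous_qPoch_left (q : ℂ) n).tendsto 0).comp hcont
    refine Tendsto.congr' ?_ ((((hlim.mul_const ((-1) ^ n)).mul_const
      ((q : ℂ) ^ (n * (n - 1) / 2))).div_const (qPoch a q n * qPoch q q n)).mul_const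
      ((a * γ * x) ^ n))
    filter_upwards [self_mem_nhdsWithin] with ε hε
    have hε' : (ε : ℂ) ≠ 0 := by exact_mod_cast (Set.mem_Ioi.1 hε).ne'
    have h : a * (ε * γ) * (x / ε) = a * γ * x := by field_simp
    rw [h, Function.comp_apply]
  · filter_upwards [self_mem_nhdsWithin,
      (hcont.norm.eventually_le_const (by simp : ‖(0 : ℂ)‖ < 1))] with ε hε hle n
    have hε' : (ε : ℂ) ≠ 0 := by exact_mod_cast (Set.mem_Ioi.1 hε).ne'
    have h : a * (ε * γ) * (x / ε) = a * γ * x := by field_simp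
    have hsplit : ∀ p r s d w : ℂ, p * r * s / d * w = p * (r * s / d * w) := by
      intros; ring
    have hpull : ∀ c r w : ℂ, r * (c * w) ^ n = c ^ n * (r * w ^ n) := by
      intros; ring
    rw [h, hsplit, hpull 2, norm_mul (qPoch _ _ _), norm_mul (2 ^ n),
      norm_pow (2 : ℂ), Complex.norm_ofNat]
    exact mul_le_mul_of_nonneg_right (norm_qPoch_le hle hqn.le n) (norm_nonneg _)
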